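/- For every oracle A ⊆ ℕ the following are equivalent: (i) A is of hyperimmune degree; (ii) A is Schnorr-Kurtz engulfing, i.e., the union of all Kurtz null sets is contained in a set that is Schnorr null relative to A. -/

import Mathlib

open Filter

namespace CichonAnalog

/-! ### Oracle computability -/

/-- Partial functions `ℕ →. ℕ` partial recursive relative to the oracle `A ⊆ ℕ`.
This is Mathlib's `Nat.Partrec` with an extra base case for the characteristic
function of the oracle. -/
inductive RecursiveIn (A : Set ℕ) : (ℕ →. ℕ) → Prop
  | zero : RecursiveIn A (pure 0)
  | succ : RecursiveIn A ↑Nat.succ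
  | left : RecursiveIn A ↑fun n : ℕ => n.unpair.1
  | right : RecursiveIn A ↑fun n : ℕ => n.unpair.2
  | oracle : RecursiveIn A ↑fun n : ℕ => A.indicator (fun _ => 1) n
  | pair {f g} : RecursiveIn A f → RecursiveIn A g →
      RecursiveIn A fun n => Nat.pair <$> f n <*> g n
  | comp {f g} : RecursiveIn A f → RecursiveIn A g →
      RecursiveIn A fun n => g n >>= f
  | prec {f g} : RecursiveIn A f → RecursiveIn A g →
      RecursiveIn A (Nat.unpaired fun a n =>
        n.rec (f a) fun y IH => do let i ← IH; g (Nat.pair a (Nat.pair y i)))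
  | rfind {f} : RecursiveIn A f →
      RecursiveIn A fun a => Nat.rfind fun n => (fun m => m = 0) <$> f (Nat.pair a n)

/-- The partial function `f` (between coded spaces) is partial recursive in the oracle `A`. -/
def PartrecIn (A : Set ℕ) {α σ : Type} [Primcodable α] [Primcodable σ] (f : α →. σ) : Prop :=
  RecursiveIn A fun n =>
    Part.bind ↑(Encodable.decode (α := α) n) fun a => (f a).map Encodable.encode

/-- `f ≤_T A` : the (total) function `f` is computable from the oracle `A`. -/
def ComputableIn (A : Set ℕ) {α σ : Type} [Primcodable α] [Primcodable σ] (f : α → σ) : Prop :=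
  PartrecIn A (f : α →. σ)

/-- `W` is computably enumerable in the oracle `A`. -/
def CEIn (A : Set ℕ) {α : Type} [Primcodable α] (W : Set α) : Prop :=
  ∃ f : α →. ℕ, PartrecIn A f ∧ ∀ a, a ∈ W ↔ (f a).Dom

/-- `W` is computably enumerable (unrelativized). -/
def CE {α : Type} [Primcodable α] (W : Set α) : Prop :=
  ∃ f : α →. ℕ, Partrec f ∧ ∀ a, a ∈ W ↔ (f a).Dom

/-! ### Cantor space, `Π⁰₁` classes, effective meagerness -/

/-- The basic clopen set (cylinder) of the finite binary string `σ` in Cantor space. -/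
def Cyl (σ : List Bool) : Set (ℕ → Bool) :=
  {x | ∀ i, i < σ.length → x i = σ.getD i false}

/-- `P` is a `Π⁰₁(A)` class: a closed subset of Cantor space whose complement is the
union of basic clopen sets over a set of strings c.e. in `A`. -/
def Pi01In (A : Set ℕ) (P : Set (ℕ → Bool)) : Prop :=
  ∃ W : Set (List Bool), CEIn A W ∧ P = (⋃ σ ∈ W, Cyl σ)ᶜ

/-- `P` is a (plain) `Π⁰₁` class. -/
def Pi01 (P : Set (ℕ → Bool)) : Prop :=
  ∃ W : Set (List Bool), CE W ∧ P = (⋃ σ ∈ W, Cyl σ)ᶜ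

/-- `C` is a uniformly `Π⁰₁(A)` sequence of classes. -/
def UnifPi01In (A : Set ℕ) (C : ℕ → Set (ℕ → Bool)) : Prop :=
  ∃ W : Set (ℕ × List Bool), CEIn A W ∧
    ∀ m, C m = (⋃ σ ∈ {s | (m, s) ∈ W}, Cyl σ)ᶜ

/-- `C` is a uniformly `Π⁰₁` sequence of classes. -/
def UnifPi01 (C : ℕ → Set (ℕ → Bool)) : Prop :=
  ∃ W : Set (ℕ × List Bool), CE W ∧
    ∀ m, C m = (⋃ σ ∈ {s | (m, s) ∈ W}, Cyl σ)ᶜ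

/-- `S` is effectively meager relative to `A`: it is contained in the union of a
uniformly `Π⁰₁(A)` sequence of nowhere dense classes. -/
def EffMeagerIn (A : Set ℕ) (S : Set (ℕ → Bool)) : Prop :=
  ∃ C : ℕ → Set (ℕ → Bool), UnifPi01In A C ∧ (∀ m, IsNowhereDense (C m)) ∧ S ⊆ ⋃ m, C m

/-- `S` is effectively meager (unrelativized). -/
def EffMeager (S : Set (ℕ → Bool)) : Prop :=
  ∃ C : ℕ → Set (ℕ → Bool), UnifPi01 C ∧ (∀ m, IsNowhereDense (C m)) ∧ S ⊆ ⋃ m, C m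

/-- `A` is meager engulfing: some `A`-effectively meager set contains every
effectively meager set. -/
def MeagerEngulfing (A : Set ℕ) : Prop :=
  ∃ S, EffMeagerIn A S ∧ ∀ T, EffMeager T → T ⊆ S

/-- `A` is weakly meager engulfing: some `A`-effectively meager set contains every
computable element of Cantor space. -/
def WeaklyMeagerEngulfing (A : Set ℕ) : Prop :=
  ∃ S, EffMeagerIn A S ∧ ∀ x : ℕ → Bool, Computable x → x ∈ S

/-- `V` is a computable set of finite binary strings. -/
def ComputableStringSet (V : Set (List Bool)) : Prop :=
  ∃ χ : List Bool → Bool, Computable χ ∧ ∀ s, s ∈ V ↔ χ s = true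

/-- `V` is a dense set of finite binary strings: every string has an extension in `V`. -/
def DenseStringSet (V : Set (List Bool)) : Prop :=
  ∀ σ : List Bool, ∃ τ ∈ V, σ <+: τ

/-- `x ∈ 2^ω` is weakly 1-generic: for every computable dense set `V` of finite
binary strings, some initial segment of `x` lies in `V`. -/
def Weakly1Generic (x : ℕ → Bool) : Prop :=
  ∀ V : Set (List Bool), ComputableStringSet V → DenseStringSet V →
    ∃ n, (List.ofFn fun i : Fin n => x i) ∈ V

/-! ### Domination properties -/

/-- `A` is high: `A` computes a function dominating every total computable function. -/
def High (A : Set ℕ) : Prop :=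
  ∃ f : ℕ → ℕ, ComputableIn A f ∧
    ∀ g : ℕ → ℕ, Computable g → ∀ᶠ n in atTop, g n ≤ f n

/-- `A` is of hyperimmune degree: `A` computes a function not dominated by any
computable function. -/
def HyperimmuneDegree (A : Set ℕ) : Prop :=
  ∃ f : ℕ → ℕ, ComputableIn A f ∧
    ∀ g : ℕ → ℕ, Computable g → ∃ᶠ n in atTop, g n < f n

/-- `A` is of hyperimmune-free degree: every function computable in `A` is dominated
by a total computable function. -/
def HyperimmuneFree (A : Set ℕ) : Prop :=
  ∀ f : ℕ → ℕ, ComputableIn A f →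
    ∃ g : ℕ → ℕ, Computable g ∧ ∀ᶠ n in atTop, f n ≤ g n

/-! ### Measure on Cantor space, Kurtz and Schnorr tests -/

open scoped Classical in
/-- The uniform measure of the clopen set `⋃ σ ∈ F, [σ]` determined by the finite
list `F` of binary strings: count the binary strings of maximal length extending
some member of `F`, and normalize. -/
noncomputable def listMeasure (F : List (List Bool)) : ℚ :=
  letI k := (F.map List.length).foldr max 0
  ((Finset.univ.filter fun v : Fin k → Bool =>
      ∃ σ ∈ F, σ <+: List.ofFn v).card : ℚ) / 2 ^ k

/-- The clopen subset of Cantor space given explicitly as a finite union of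
basic clopen sets. -/
def ClopSet (F : List (List Bool)) : Set (ℕ → Bool) := ⋃ σ ∈ F, Cyl σ

/-- The effectively open subset of Cantor space enumerated by the sequence of
finite stages `g`. -/
def OpenSet (g : ℕ → List (List Bool)) : Set (ℕ → Bool) := ⋃ s, ClopSet (g s)

/-- The measure of the open set enumerated by the stages `g`: the supremum of the
measures of its finite partial unions. -/
noncomputable def openMeasure (g : ℕ → List (List Bool)) : ℝ :=
  ⨆ s : ℕ, (listMeasure ((List.range (s + 1)).flatMap g) : ℝ)

/-- A Kurtz test relative to `A`: an `A`-computable sequence of explicitly given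
clopen sets, the `m`-th of measure at most `2 ^ (-m)`. -/
def KurtzTestIn (A : Set ℕ) (G : ℕ → List (List Bool)) : Prop :=
  ComputableIn A G ∧ ∀ m, listMeasure (G m) ≤ (1 / 2) ^ m

/-- A (plain) Kurtz test. -/
def KurtzTest (G : ℕ → List (List Bool)) : Prop :=
  Computable G ∧ ∀ m, listMeasure (G m) ≤ (1 / 2) ^ m

/-- A Schnorr test relative to `A`: an `A`-computable doubly indexed sequence of finite
stages such that the `m`-th effectively open set `⋃ s, ClopSet (g m s)` has measure at
most `2 ^ (-m)`, and this measure is a real computable in `A` uniformly in `m`. -/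
def SchnorrTestIn (A : Set ℕ) (g : ℕ → ℕ → List (List Bool)) : Prop :=
  ComputableIn A (fun p : ℕ × ℕ => g p.1 p.2) ∧
  (∀ m, openMeasure (g m) ≤ (1 / 2) ^ m) ∧
  ∃ q : ℕ × ℕ → ℚ, ComputableIn A q ∧
    ∀ m k, |openMeasure (g m) - (q (m, k) : ℝ)| ≤ (1 / 2) ^ k

/-- A (plain) Schnorr test. -/
def SchnorrTest (g : ℕ → ℕ → List (List Bool)) : Prop :=
  Computable (fun p : ℕ × ℕ => g p.1 p.2) ∧
  (∀ m, openMeasure (g m) ≤ (1 / 2) ^ m) ∧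
  ∃ q : ℕ × ℕ → ℚ, Computable q ∧
    ∀ m k, |openMeasure (g m) - (q (m, k) : ℝ)| ≤ (1 / 2) ^ k

/-- `N` is Schnorr null relative to `A`. -/
def SchnorrNullIn (A : Set ℕ) (N : Set (ℕ → Bool)) : Prop :=
  ∃ g, SchnorrTestIn A g ∧ N ⊆ ⋂ m, OpenSet (g m)

/-- `N` is Schnorr null (unrelativized). -/
def SchnorrNull (N : Set (ℕ → Bool)) : Prop :=
  ∃ g, SchnorrTest g ∧ N ⊆ ⋂ m, OpenSet (g m)

/-- `x ∈ 2^ω` is Schnorr random: it belongs to no Schnorr null set. -/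
def SchnorrRandom (x : ℕ → Bool) : Prop := ∀ N, SchnorrNull N → x ∉ N

/-- `A` is Kurtz engulfing: there is an `A`-computable sequence of Kurtz tests relative
to `A` such that every Kurtz null set is contained in the null set of one of them. -/
def KurtzEngulfing (A : Set ℕ) : Prop :=
  ∃ G : ℕ → ℕ → List (List Bool),
    ComputableIn A (fun p : ℕ × ℕ => G p.1 p.2) ∧
    (∀ i m, listMeasure (G i m) ≤ (1 / 2) ^ m) ∧
    ∀ L, KurtzTest L → ∃ i, (⋂ m, ClopSet (L m)) ⊆ ⋂ m, ClopSet (G i m)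

/-- `A` is weakly Kurtz engulfing: there is an `A`-computable sequence of Kurtz tests
relative to `A` such that the union of their null sets contains every computable
element of Cantor space. -/
def WeaklyKurtzEngulfing (A : Set ℕ) : Prop :=
  ∃ G : ℕ → ℕ → List (List Bool),
    ComputableIn A (fun p : ℕ × ℕ => G p.1 p.2) ∧
    (∀ i m, listMeasure (G i m) ≤ (1 / 2) ^ m) ∧
    ∀ x : ℕ → Bool, Computable x → ∃ i, x ∈ ⋂ m, ClopSet (G i m)

/-- `A` is weakly Schnorr engulfing: some set Schnorr null relative to `A` contains
every computable element of Cantor space. -/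
def WeaklySchnorrEngulfing (A : Set ℕ) : Prop :=
  ∃ N, SchnorrNullIn A N ∧ ∀ x : ℕ → Bool, Computable x → x ∈ N

/-! ### DNR and PA degrees -/

/-- The `e`-th partial computable function. -/
noncomputable def phi (e : ℕ) : ℕ →. ℕ := (Denumerable.ofNat Nat.Partrec.Code e).eval

/-- `h` is diagonally nonrecursive. -/
def DNRFun (h : ℕ → ℕ) : Prop := ∀ e, ∀ y ∈ phi e e, h e ≠ y

/-- `A` is DNR: `A` computes a diagonally nonrecursive function. -/
def DNRDegree (A : Set ℕ) : Prop := ∃ h : ℕ → ℕ, ComputableIn A h ∧ DNRFun h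

/-- `A` is PA: `A` computes a `{0,1}`-valued diagonally nonrecursive function. -/
def PA (A : Set ℕ) : Prop :=
  ∃ h : ℕ → ℕ, ComputableIn A h ∧ (∀ e, h e ≤ 1) ∧ DNRFun h

/-! ### Traces -/

/-- The trace `σ` (satisfying `|σ n| ≤ n`) traces the function `f` if
`f n ∈ σ n` for all but finitely many `n`. -/
def Traces (σ : ℕ → Finset ℕ) (f : ℕ → ℕ) : Prop := ∀ᶠ n in atTop, f n ∈ σ n

/-- `σ` is a `(D, g)`-trace relative to `A`: `D` is infinite and c.e. in `A`, `g` is a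
partial `A`-computable function with `D ⊆ dom g` and `g n ≥ n` on its domain, and `σ`
is partial `A`-computable, defined on `D`, with `|σ n| < g n` for all `n ∈ D`. -/
def IsDGTraceIn (A : Set ℕ) (D : Set ℕ) (g : ℕ →. ℕ) (σ : ℕ →. Finset ℕ) : Prop :=
  D.Infinite ∧ CEIn A D ∧ PartrecIn A g ∧ D ⊆ g.Dom ∧ (∀ n, ∀ y ∈ g n, n ≤ y) ∧
  PartrecIn A σ ∧ D ⊆ σ.Dom ∧ ∀ n ∈ D, ∀ S ∈ σ n, ∀ b ∈ g n, S.card < b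

/-- `σ` is a `(D, g)`-trace (unrelativized). -/
def IsDGTrace (D : Set ℕ) (g : ℕ →. ℕ) (σ : ℕ →. Finset ℕ) : Prop :=
  D.Infinite ∧ CE D ∧ Partrec g ∧ D ⊆ g.Dom ∧ (∀ n, ∀ y ∈ g n, n ≤ y) ∧
  Partrec σ ∧ D ⊆ σ.Dom ∧ ∀ n ∈ D, ∀ S ∈ σ n, ∀ b ∈ g n, S.card < b

/-- The `(D, g)`-trace `σ` traces `f`: `f n ∈ σ n` for all but finitely many `n ∈ D`. -/
def DGTraces (D : Set ℕ) (σ : ℕ →. Finset ℕ) (f : ℕ → ℕ) : Prop :=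
  ∀ᶠ n in atTop, n ∈ D → ∀ S ∈ σ n, f n ∈ S

/-! ### Closure properties of relative computability -/

section Oracle

variable {A : Set ℕ} {α β σ : Type} [Primcodable α] [Primcodable β] [Primcodable σ]

theorem RecursiveIn.of_partrec {f : ℕ →. ℕ} (hf : Nat.Partrec f) : RecursiveIn A f := by
  induction hf with
  | zero => exact .zero
  | succ => exact .succ
  | left => exact .left
  | right => exact .right
  | pair _ _ h₁ h₂ => exact .pair h₁ h₂
  | comp _ _ h₁ h₂ => exact .comp h₁ h₂
  | prec _ _ h₁ h₂ => exact .prec h₁ h₂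
  | rfind _ h => exact .rfind h

theorem RecursiveIn.of_eq {f g : ℕ →. ℕ} (hf : RecursiveIn A f) (H : ∀ n, g n = f n) :
    RecursiveIn A g :=
  (funext H : g = f) ▸ hf

theorem ComputableIn.of_computable {f : α → σ} (hf : Computable f) : ComputableIn A f :=
  RecursiveIn.of_partrec hf

theorem ComputableIn.comp {g : β → σ} {f : α → β} (hg : ComputableIn A g)
    (hf : ComputableIn A f) : ComputableIn A fun a => g (f a) := by
  have h := RecursiveIn.comp hg hf
  refine h.of_eq fun n => ?_
  cases hn : (Encodable.decode n : Option α) with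
  | none => simp [Part.bind_eq_bind]
  | some a => simp [PFun.coe_val, Part.bind_eq_bind, Encodable.encodek]

theorem ComputableIn.pair {f : α → β} {g : α → σ} (hf : ComputableIn A f)
    (hg : ComputableIn A g) : ComputableIn A fun a => (f a, g a) := by
  have h := RecursiveIn.pair hf hg
  refine h.of_eq fun n => ?_
  cases hn : (Encodable.decode n : Option α) with
  | none => simp [Seq.seq]
  | some a => simp [PFun.coe_val, Seq.seq]

theorem ComputableIn.nat_rec (s : σ) {h : ℕ × σ → σ} (hh : ComputableIn A h) :
    ComputableIn A fun n : ℕ => (Nat.rec s (fun y ih => h (y, ih)) n : σ) := by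
  have hc : RecursiveIn A fun _ => Part.some (Encodable.encode s) :=
    .of_partrec (Nat.Partrec.of_primrec (Nat.Primrec.const _))
  have hstep := RecursiveIn.comp hh RecursiveIn.right
  have hp : RecursiveIn A fun n : ℕ => Part.some (Nat.pair 0 n) :=
    .of_partrec (Nat.Partrec.of_primrec (Nat.Primrec.pair (Nat.Primrec.const 0) Nat.Primrec.id))
  have h := RecursiveIn.comp (RecursiveIn.prec hc hstep) hp
  refine h.of_eq fun n => ?_
  simp only [Encodable.decode_nat, Part.coe_some, Part.bind_some, PFun.coe_val, Part.map_some,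
    Nat.unpaired, Nat.unpair_pair, Part.bind_eq_bind]
  induction n with
  | zero => rfl
  | succ n ih =>
    dsimp only
    rw [← ih]
    simp [Encodable.encodek]

theorem ComputableIn.map_range {f : ℕ → σ} (hf : ComputableIn A f) :
    ComputableIn A fun n => (List.range n).map f := by
  have hstep : ComputableIn A fun p : ℕ × List σ => p.2 ++ [f p.1] :=
    (ComputableIn.of_computable (A := A) (f := fun q : List σ × σ => q.1 ++ [q.2])
      (Primrec.list_concat (α := σ)).to_comp).comp
      ((ComputableIn.of_computable Computable.snd).pair
        (hf.comp (ComputableIn.of_computable Computable.fst)))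
  convert ComputableIn.nat_rec [] hstep using 2 with n
  induction n with
  | zero => rfl
  | succ n ih => rw [List.range_succ, List.map_append, ih]; rfl

/-- Unbounded search relative to an oracle. -/
theorem ComputableIn.exists_search {p : ℕ × ℕ → Bool} (hp : ComputableIn A p)
    (h : ∀ n, ∃ k, p (n, k) = true) :
    ∃ s : ℕ → ℕ, ComputableIn A s ∧ ∀ n, p (n, s n) = true := by
  refine ⟨fun n => Nat.find (h n), ?_, fun n => Nat.find_spec (h n)⟩
  have hb : Computable fun b : Bool => cond b 0 1 :=
    Computable.cond Computable.id (.const 0) (.const 1)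
  have h' := RecursiveIn.rfind ((ComputableIn.of_computable hb).comp hp)
  refine h'.of_eq fun n => ?_
  symm
  simp only [Encodable.decode_nat, Part.coe_some, Part.bind_some, PFun.coe_val, Part.map_some]
  refine Part.eq_some_iff.2 (Nat.mem_rfind.2 ⟨?_, fun {m} hm => ?_⟩)
  · simp [Nat.find_spec (h n)]
  · have := Nat.find_min (h n) hm
    simp [this]

end Oracle

/-! ### Computability on the rationals -/

section Rational

/-- The pair code (numerator, denominator) of the `n`-th rational number. -/
def ratCode (n : ℕ) : ℕ :=
  Nat.pair (Encodable.encode (Denumerable.ofNat ℚ n).num) (Denumerable.ofNat ℚ n).den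

/-- Being the pair code of the reduced fraction of a rational number. -/
def IsRatCode (c : ℕ) : Prop :=
  0 < c.unpair.2 ∧ ((c.unpair.1 + 1) / 2).Coprime c.unpair.2

theorem encode_rat (q : ℚ) :
    @Encodable.encode ℚ Rat.instEncodable q = Nat.pair (Encodable.encode q.num) q.den := by
  cases q; rfl

theorem Int.natAbs_eq_encode (z : ℤ) : z.natAbs = (Encodable.encode z + 1) / 2 := by
  cases z with
  | ofNat n => change n = (2 * n + 1) / 2; omega
  | negSucc n => change n + 1 = (2 * n + 1 + 1) / 2; omega

theorem Int.toNat_eq_encode (z : ℤ) :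
    z.toNat = if Encodable.encode z % 2 = 0 then Encodable.encode z / 2 else 0 := by
  cases z with
  | ofNat n =>
    change n = if (2 * n) % 2 = 0 then (2 * n) / 2 else 0
    rw [if_pos (by omega)]; omega
  | negSucc n =>
    change 0 = if (2 * n + 1) % 2 = 0 then (2 * n + 1) / 2 else 0
    rw [if_neg (by omega)]

theorem mem_range_encode_rat {c : ℕ} :
    c ∈ Set.range (@Encodable.encode ℚ Rat.instEncodable) ↔ IsRatCode c := by
  constructor
  · rintro ⟨q, rfl⟩
    rw [encode_rat, IsRatCode, Nat.unpair_pair, ← Int.natAbs_eq_encode]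
    exact ⟨q.pos, q.reduced⟩
  · rintro ⟨h₁, h₂⟩
    refine ⟨⟨Denumerable.ofNat ℤ c.unpair.1, c.unpair.2, h₁.ne', ?_⟩, ?_⟩
    · rwa [Int.natAbs_eq_encode, Denumerable.encode_ofNat]
    · rw [encode_rat]
      dsimp only
      rw [Denumerable.encode_ofNat, Nat.pair_unpair]

theorem isRatCode_ratCode_and_next (n : ℕ) :
    IsRatCode (ratCode (n + 1)) ∧ ratCode n < ratCode (n + 1) ∧
      ∀ c, ratCode n < c → c < ratCode (n + 1) → ¬ IsRatCode c := by
  let _ := Encodable.decidableRangeEncode ℚ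
  let _ : Infinite (Set.range (@Encodable.encode ℚ _)) :=
    Infinite.of_injective _ (Equiv.ofInjective _ Encodable.encode_injective).injective
  have key (n : ℕ) :
      ratCode n = (Nat.Subtype.ofNat (Set.range (@Encodable.encode ℚ _)) n : ℕ) := by
    rw [ratCode, ← encode_rat]
    exact congrArg Subtype.val ((Encodable.equivRangeEncode ℚ).apply_symm_apply _)
  rw [key, key, ← mem_range_encode_rat]
  refine ⟨Subtype.property _, Nat.Subtype.lt_succ_self _, fun c h₁ h₂ hc => ?_⟩
  rw [← mem_range_encode_rat] at hc
  exact absurd h₂ (not_lt.2 (Nat.Subtype.succ_le_of_lt (x := ⟨c, hc⟩) h₁))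

theorem primrecPred_isRatCode : PrimrecPred IsRatCode := by
  have hb : Primrec fun c : ℕ => c.unpair.2 := Primrec.snd.comp Primrec.unpair
  have ha : Primrec fun c : ℕ => (c.unpair.1 + 1) / 2 :=
    Primrec.nat_div.comp (Primrec.succ.comp (Primrec.fst.comp Primrec.unpair)) (Primrec.const 2)
  have hR : PrimrecRel fun d c : ℕ =>
      d = 1 ∨ ¬ (((c.unpair.1 + 1) / 2) % d = 0 ∧ c.unpair.2 % d = 0) := by
    refine PrimrecPred.or (Primrec.eq.comp Primrec.fst (Primrec.const 1))
      (PrimrecPred.not (PrimrecPred.and ?_ ?_))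
    · exact Primrec.eq.comp (Primrec.nat_mod.comp (ha.comp Primrec.snd) Primrec.fst)
        (Primrec.const 0)
    · exact Primrec.eq.comp (Primrec.nat_mod.comp (hb.comp Primrec.snd) Primrec.fst)
        (Primrec.const 0)
  have h := PrimrecPred.and (Primrec.nat_lt.comp (Primrec.const 0) hb)
    ((PrimrecRel.forall_lt hR).comp (Primrec.succ.comp hb) Primrec.id)
  refine h.of_eq fun c => and_congr_right fun hc => ?_
  simp only [id]
  constructor
  · intro H
    have hd := Nat.gcd_dvd_right ((c.unpair.1 + 1) / 2) c.unpair.2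
    exact (H _ (Nat.lt_succ_of_le (Nat.le_of_dvd hc hd))).resolve_right fun H' =>
      H' ⟨Nat.mod_eq_zero_of_dvd (Nat.gcd_dvd_left _ _), Nat.mod_eq_zero_of_dvd hd⟩
  · intro H d _
    rw [or_iff_not_imp_right, not_not]
    rintro ⟨h₁, h₂⟩
    exact Nat.eq_one_of_dvd_coprimes H (Nat.dvd_of_mod_eq_zero h₁) (Nat.dvd_of_mod_eq_zero h₂)

theorem computable_search {α : Type} [Primcodable α] {p : α → ℕ → Prop} {f : α → ℕ}
    (hp : ∃ b : α × ℕ → Bool, Computable b ∧ ∀ a n, b (a, n) = true ↔ p a n)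
    (h₁ : ∀ a, p a (f a)) (h₂ : ∀ a, ∀ m < f a, ¬ p a m) : Computable f := by
  obtain ⟨b, hb, hbp⟩ := hp
  have h : Partrec fun a => Nat.rfind fun n => (Part.some (b (a, n))) :=
    Partrec.rfind (p := fun a n => Part.some (b (a, n))) hb
  refine h.of_eq fun a => Part.eq_some_iff.2 (Nat.mem_rfind.2 ⟨?_, fun {m} hm => ?_⟩)
  · rw [(hbp _ _).2 (h₁ a)]
    exact Part.mem_some _
  · have := mt (hbp _ _).1 (h₂ a m hm)
    rw [Bool.not_eq_true] at this
    rw [this]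
    exact Part.mem_some _

theorem computable_ratCode : Computable ratCode := by
  classical
  have hex (y : ℕ) : ∃ k, IsRatCode (y + k + 1) := by
    have hlt : ∀ n, n ≤ ratCode n := fun n => by
      induction n with
      | zero => exact Nat.zero_le _
      | succ n ih => exact lt_of_le_of_lt ih (isRatCode_ratCode_and_next n).2.1
    refine ⟨ratCode (y + 1) - (y + 1), ?_⟩
    have := hlt (y + 1)
    rw [show y + (ratCode (y + 1) - (y + 1)) + 1 = ratCode (y + 1) by omega]
    exact (isRatCode_ratCode_and_next y).1
  have hS : Computable fun y => Nat.find (hex y) := by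
    refine computable_search (p := fun y k => IsRatCode (y + k + 1))
      ⟨fun q => decide (IsRatCode (q.1 + q.2 + 1)), ?_, by simp⟩ (fun y => Nat.find_spec (hex y))
      (fun y m hm => Nat.find_min (hex y) hm)
    exact (primrecPred_isRatCode.comp (f := fun q : ℕ × ℕ => q.1 + q.2 + 1)
      (Primrec.succ.comp Primrec.nat_add)).decide.to_comp
  have hrec : Computable fun n : ℕ =>
      (Nat.rec (ratCode 0) (fun _ y => y + Nat.find (hex y) + 1) n : ℕ) := by
    refine Computable.nat_rec Computable.id (Computable.const (ratCode 0))
      (h := fun _ p : _ => p.2 + Nat.find (hex p.2) + 1) ?_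
    have hy : Computable fun q : ℕ × ℕ × ℕ => q.2.2 := Computable.snd.comp Computable.snd
    exact Computable.succ.comp (Primrec.nat_add.to_comp.comp hy (hS.comp hy))
  refine hrec.of_eq fun n => ?_
  induction n with
  | zero => rfl
  | succ n ih =>
    dsimp only
    rw [ih]
    obtain ⟨h₁, h₂, h₃⟩ := isRatCode_ratCode_and_next n
    have hf := Nat.find_spec (hex (ratCode n))
    rcases lt_trichotomy (ratCode n + Nat.find (hex (ratCode n)) + 1) (ratCode (n + 1))
      with h | h | h
    · exact absurd hf (h₃ _ (by omega) h)
    · exact h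
    · refine absurd ?_ (Nat.find_min (hex (ratCode n))
        (m := ratCode (n + 1) - ratCode n - 1) (by omega))
      rwa [show ratCode n + (ratCode (n + 1) - ratCode n - 1) + 1 = ratCode (n + 1) by omega]

theorem computable_rat_code :
    Computable fun q : ℚ => Nat.pair (Encodable.encode q.num) q.den :=
  (computable_ratCode.comp Computable.encode).of_eq fun q => by
    rw [ratCode, Denumerable.ofNat_encode]

theorem computable_rat_den : Computable fun q : ℚ => q.den :=
  (Computable.snd.comp (Primrec.unpair.to_comp.comp computable_rat_code)).of_eq fun q => by simp

theorem computable_rat_num_toNat : Computable fun q : ℚ => q.num.toNat := by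
  have he : Computable fun q : ℚ => Encodable.encode q.num :=
    (Computable.fst.comp (Primrec.unpair.to_comp.comp computable_rat_code)).of_eq fun q => by simp
  have h : Primrec fun c : ℕ => if c % 2 = 0 then c / 2 else 0 :=
    Primrec.ite (Primrec.eq.comp (Primrec.nat_mod.comp Primrec.id (Primrec.const 2))
      (Primrec.const 0)) (Primrec.nat_div.comp Primrec.id (Primrec.const 2)) (Primrec.const 0)
  exact (h.to_comp.comp he).of_eq fun q => (Int.toNat_eq_encode _).symm

theorem Int.eq_of_encode_even {z : ℤ} (h : Encodable.encode z % 2 = 0) :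
    z = ((Encodable.encode z / 2 : ℕ) : ℤ) := by
  cases z with
  | ofNat n =>
    change (n : ℤ) = ((2 * n / 2 : ℕ) : ℤ)
    omega
  | negSucc n =>
    change (2 * n + 1) % 2 = 0 at h
    omega

theorem Int.encode_natCast (n : ℕ) : Encodable.encode (n : ℤ) = 2 * n := rfl

theorem computable_natCast_div :
    Computable fun p : ℕ × ℕ => ((p.1 : ℚ) / ((p.2 + 1 : ℕ) : ℚ)) := by
  classical
  refine Computable.encode_iff.1 (computable_search (p := fun p n => (ratCode n).unpair.1 % 2 = 0 ∧
    (ratCode n).unpair.1 / 2 * (p.2 + 1) = p.1 * (ratCode n).unpair.2)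
    ⟨fun q => decide ((ratCode q.2).unpair.1 % 2 = 0 ∧
      (ratCode q.2).unpair.1 / 2 * (q.1.2 + 1) = q.1.1 * (ratCode q.2).unpair.2), ?_, by simp⟩
    (fun p => ?_) fun p n hn => ?_)
  · have h : Primrec fun t : (ℕ × ℕ) × ℕ × ℕ => decide (t.2.1 % 2 = 0 ∧
        t.2.1 / 2 * (t.1.2 + 1) = t.1.1 * t.2.2) := by
      have h₁ : Primrec fun t : (ℕ × ℕ) × ℕ × ℕ => t.2.1 := Primrec.fst.comp Primrec.snd
      refine PrimrecPred.decide (PrimrecPred.and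
        (Primrec.eq.comp (Primrec.nat_mod.comp h₁ (Primrec.const 2)) (Primrec.const 0)) (Primrec.eq.comp (Primrec.nat_mul.comp
        (Primrec.nat_div.comp h₁ (Primrec.const 2))
        (Primrec.succ.comp (Primrec.snd.comp Primrec.fst))) (Primrec.nat_mul.comp
        (Primrec.fst.comp Primrec.fst) (Primrec.snd.comp Primrec.snd))))
    have hc : Computable fun q : (ℕ × ℕ) × ℕ => (q.1, (ratCode q.2).unpair) :=
      Computable.fst.pair (Primrec.unpair.to_comp.comp (computable_ratCode.comp Computable.snd))
    exact (h.to_comp.comp hc : _)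
  · rw [ratCode, Denumerable.ofNat_encode, Nat.unpair_pair]
    have hnum : 0 ≤ ((p.1 : ℚ) / ((p.2 + 1 : ℕ) : ℚ)).num := Rat.num_nonneg.2 (by positivity)
    generalize hq : ((p.1 : ℚ) / ((p.2 + 1 : ℕ) : ℚ)) = q at hnum
    obtain ⟨k, hk⟩ := Int.eq_ofNat_of_zero_le hnum
    have hqk : (p.1 : ℚ) / ((p.2 + 1 : ℕ) : ℚ) = k / q.den := by
      rw [hq, ← Int.cast_natCast k, ← hk, Rat.num_div_den]
    have hd : (q.den : ℚ) ≠ 0 := by exact_mod_cast q.den_nz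
    rw [div_eq_div_iff (by positivity) hd] at hqk
    dsimp only
    rw [hk, Int.encode_natCast]
    refine ⟨by omega, ?_⟩
    rw [Nat.mul_div_cancel_left _ two_pos]
    exact_mod_cast hqk.symm
  · rintro ⟨h₁, h₂⟩
    rw [ratCode, Nat.unpair_pair] at h₁ h₂
    refine hn.ne ?_
    rw [← Denumerable.encode_ofNat (α := ℚ) n]
    congr 1
    generalize Denumerable.ofNat ℚ n = q at h₁ h₂ ⊢
    have hd : (q.den : ℚ) ≠ 0 := by exact_mod_cast q.den_nz
    dsimp only at h₁ h₂
    rw [← Rat.num_div_den q, Int.eq_of_encode_even h₁, div_eq_div_iff hd (by positivity)]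
    exact_mod_cast h₂

end Rational

/-! ### Computability of the measure of clopen sets -/

section ListMeasure

/-- The list of all binary strings of length `n`. -/
def allStrings (n : ℕ) : List (List Bool) :=
  Nat.rec [[]] (fun _ l => l.flatMap fun σ => [false :: σ, true :: σ]) n

/-- The maximal length of a string in `F`. -/
def maxLength (F : List (List Bool)) : ℕ := (F.map List.length).foldr max 0

open scoped Classical in
/-- The strings of maximal length extending a member of `F`. -/
noncomputable def extensions (F : List (List Bool)) : List (List Bool) :=
  (allStrings (maxLength F)).filter fun v => ∃ σ ∈ F, σ <+: v

theorem allStrings_succ (n : ℕ) :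
    allStrings (n + 1) = (allStrings n).flatMap fun σ => [false :: σ, true :: σ] := rfl

theorem mem_allStrings {n : ℕ} {σ : List Bool} : σ ∈ allStrings n ↔ σ.length = n := by
  induction n generalizing σ with
  | zero => simp [allStrings]
  | succ n ih =>
    rw [allStrings_succ]
    simp only [List.mem_flatMap, ih]
    cases σ with
    | nil => simp
    | cons b σ => cases b <;> simp

theorem nodup_allStrings (n : ℕ) : (allStrings n).Nodup := by
  induction n with
  | zero => simp [allStrings]
  | succ n ih =>
    rw [allStrings_succ, List.nodup_flatMap]
    refine ⟨fun σ _ => by simp, ih.imp fun h => ?_⟩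
    simp [Function.onFun, h.symm]

theorem le_maxLength {F : List (List Bool)} {σ : List Bool} (h : σ ∈ F) :
    σ.length ≤ maxLength F := by
  induction F with
  | nil => simp at h
  | cons τ F ih =>
    rw [maxLength, List.map_cons, List.foldr_cons]
    rcases List.mem_cons.1 h with rfl | h
    · exact le_max_left _ _
    · exact (ih h).trans (le_max_right _ _)

theorem mem_extensions {F : List (List Bool)} {v : List Bool} :
    v ∈ extensions F ↔ v.length = maxLength F ∧ ∃ σ ∈ F, σ <+: v := by
  simp [extensions, mem_allStrings]

theorem nodup_extensions (F : List (List Bool)) : (extensions F).Nodup :=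
  (nodup_allStrings _).filter _

theorem listMeasure_eq (F : List (List Bool)) :
    listMeasure F = ((extensions F).length : ℚ) / 2 ^ maxLength F := by
  classical
  rw [listMeasure]
  congr 2
  rw [← List.toFinset_card_of_nodup (nodup_extensions F)]
  refine Finset.card_bij (fun v _ => List.ofFn v) (fun v hv => ?_) (fun v _ w _ h => ?_)
    fun v hv => ?_
  · rw [List.mem_toFinset, mem_extensions]
    exact ⟨List.length_ofFn, (Finset.mem_filter.1 hv).2⟩
  · exact List.ofFn_injective h
  · rw [List.mem_toFinset, mem_extensions] at hv
    obtain ⟨hv, h⟩ := hv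
    change v.length = (F.map List.length).foldr max 0 at hv
    generalize (F.map List.length).foldr max 0 = k at hv
    subst hv
    exact ⟨v.get, Finset.mem_filter.2 ⟨Finset.mem_univ _, by rwa [List.ofFn_get]⟩,
      List.ofFn_get v⟩

theorem primrec_allStrings : Primrec allStrings := by
  refine Primrec.nat_rec' Primrec.id (Primrec.const [[]])
    (h := fun _ p : _ => p.2.flatMap fun σ => [false :: σ, true :: σ]) ?_
  refine Primrec.list_flatMap (Primrec.snd.comp Primrec.snd) ?_
  exact Primrec.list_cons.comp (Primrec.list_cons.comp (Primrec.const false) Primrec.snd)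
    (Primrec.list_cons.comp (Primrec.list_cons.comp (Primrec.const true) Primrec.snd)
      (Primrec.const []))

theorem primrec_maxLength : Primrec maxLength :=
  Primrec.list_foldr (Primrec.list_map Primrec.id (Primrec.list_length.comp Primrec.snd).to₂)
    (Primrec.const 0) (Primrec.nat_max.comp (Primrec.fst.comp Primrec.snd)
      (Primrec.snd.comp Primrec.snd)).to₂

theorem primrecRel_isPrefix : PrimrecRel fun σ τ : List Bool => σ <+: τ := by
  have h : PrimrecRel fun σ τ : List Bool => σ = τ.take σ.length :=
    Primrec.eq.comp Primrec.fst
      (Primrec.list_take.comp (Primrec.list_length.comp Primrec.fst) Primrec.snd)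
  exact PrimrecPred.of_eq h fun p => List.prefix_iff_eq_take.symm

theorem primrec_extensions : Primrec extensions := by
  classical
  have h : PrimrecRel fun (v : List Bool) (F : List (List Bool)) => ∃ σ ∈ F, σ <+: v :=
    (PrimrecRel.exists_mem_list primrecRel_isPrefix).comp Primrec.snd Primrec.fst
  refine ((PrimrecRel.listFilter h).comp (primrec_allStrings.comp primrec_maxLength)
    Primrec.id).of_eq fun F => ?_
  simp only [extensions]
  congr

theorem primrec_two_pow : Primrec fun n : ℕ => 2 ^ n := by
  refine (Primrec.nat_rec' (f := fun n : ℕ => n) Primrec.id (Primrec.const 1)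
    (h := fun _ p : _ => p.2 * 2) (Primrec.nat_mul.comp (Primrec.snd.comp Primrec.snd)
      (Primrec.const 2))).of_eq fun n => ?_
  induction n with
  | zero => rfl
  | succ n ih => exact (congrArg (· * 2) ih).trans (pow_succ 2 n).symm

theorem computable_listMeasure : Computable listMeasure := by
  have h : Primrec fun F => ((extensions F).length, 2 ^ maxLength F - 1) :=
    (Primrec.list_length.comp primrec_extensions).pair
      (Primrec.nat_sub.comp (primrec_two_pow.comp primrec_maxLength) (Primrec.const 1))
  refine (computable_natCast_div.comp h.to_comp).of_eq fun F => ?_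
  rw [listMeasure_eq]
  dsimp only
  rw [Nat.sub_add_cancel Nat.one_le_two_pow]
  push_cast
  rfl

end ListMeasure

/-! ### The uniform measure on Cantor space -/

section CantorMeasure

open MeasureTheory
open scoped ENNReal

/-- The uniform measure on `Bool`. -/
noncomputable def coin : Measure Bool := (PMF.uniformOfFintype Bool).toMeasure

instance : IsProbabilityMeasure coin := by unfold coin; infer_instance

/-- The uniform product measure on Cantor space. -/
noncomputable def cantor : Measure (ℕ → Bool) := Measure.infinitePi fun _ => coin

instance : IsProbabilityMeasure cantor := by unfold cantor; infer_instance

theorem coin_singleton (b : Bool) : coin {b} = 2⁻¹ := by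
  rw [coin, PMF.toMeasure_apply_singleton _ _ (measurableSet_singleton b)]
  simp

theorem coin_map_not : coin.map not = coin := by
  refine Measure.ext_of_singleton fun b => ?_
  rw [Measure.map_apply (measurable_of_finite _) (measurableSet_singleton b)]
  have : not ⁻¹' {b} = {!b} := by ext c; cases b <;> cases c <;> simp
  rw [this, coin_singleton, coin_singleton]

theorem cantor_pi (s : Finset ℕ) (b : ℕ → Bool) :
    cantor {x | ∀ i ∈ s, x i = b i} = 2⁻¹ ^ s.card := by
  have h : {x : ℕ → Bool | ∀ i ∈ s, x i = b i} = (s : Set ℕ).pi fun i => {b i} := by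
    ext x; simp [Set.mem_pi]
  rw [h, cantor, Measure.infinitePi_pi _ fun i _ => measurableSet_singleton _]
  simp [coin_singleton]

theorem measurableSet_pi (s : Finset ℕ) (b : ℕ → Bool) :
    MeasurableSet {x : ℕ → Bool | ∀ i ∈ s, x i = b i} := by
  have h : {x : ℕ → Bool | ∀ i ∈ s, x i = b i} = (s : Set ℕ).pi fun i => {b i} := by
    ext x; simp [Set.mem_pi]
  rw [h]
  exact MeasurableSet.pi s.countable_toSet fun i _ => measurableSet_singleton _

theorem Cyl_eq (σ : List Bool) :
    Cyl σ = {x | ∀ i ∈ Finset.range σ.length, x i = σ.getD i false} := by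
  ext x; simp [Cyl]

theorem measurableSet_Cyl (σ : List Bool) : MeasurableSet (Cyl σ) := by
  rw [Cyl_eq]; exact measurableSet_pi _ _

theorem cantor_Cyl (σ : List Bool) : cantor (Cyl σ) = 2⁻¹ ^ σ.length := by
  rw [Cyl_eq, cantor_pi, Finset.card_range]

theorem mem_Cyl {x : ℕ → Bool} {σ : List Bool} :
    x ∈ Cyl σ ↔ (List.range σ.length).map x = σ := by
  constructor
  · intro h
    refine List.ext_getElem (by simp) fun i h₁ h₂ => ?_
    have := h i h₂
    rw [List.getD_eq_getElem _ _ h₂] at this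
    simpa using this
  · intro h i hi
    conv_rhs => rw [← h]
    simp [List.getD_eq_getElem?_getD, hi]

theorem isPrefix_map_range {x : ℕ → Bool} {σ : List Bool} {k : ℕ} (hk : σ.length ≤ k) :
    σ <+: (List.range k).map x ↔ x ∈ Cyl σ := by
  rw [mem_Cyl, List.prefix_iff_eq_take, ← List.map_take, List.take_range, min_eq_left hk, eq_comm]

theorem mem_ClopSet {x : ℕ → Bool} {F : List (List Bool)} :
    x ∈ ClopSet F ↔ ∃ σ ∈ F, x ∈ Cyl σ := by
  simp [ClopSet]

theorem mem_ClopSet_flatMap {ι : Type} {x : ℕ → Bool} {l : List ι} {g : ι → List (List Bool)} :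
    x ∈ ClopSet (l.flatMap g) ↔ ∃ i ∈ l, x ∈ ClopSet (g i) := by
  simp only [mem_ClopSet, List.mem_flatMap]
  grind

/-- Membership in a clopen set depends only on the bits below the maximal length. -/
theorem mem_ClopSet_congr {x y : ℕ → Bool} {F : List (List Bool)}
    (h : ∀ i < maxLength F, x i = y i) : x ∈ ClopSet F ↔ y ∈ ClopSet F := by
  simp only [mem_ClopSet]
  refine exists_congr fun σ => and_congr_right fun hσ => ?_
  refine forall₂_congr fun i hi => ?_
  rw [h i (hi.trans_le (le_maxLength hσ))]

theorem measurableSet_ClopSet (F : List (List Bool)) : MeasurableSet (ClopSet F) :=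
  Set.Finite.measurableSet_biUnion (List.finite_toSet F) fun σ _ => measurableSet_Cyl σ

theorem ClopSet_eq_biUnion_extensions (F : List (List Bool)) :
    ClopSet F = ⋃ v ∈ (extensions F).toFinset, Cyl v := by
  ext x
  simp only [mem_ClopSet, Set.mem_iUnion, List.mem_toFinset, mem_extensions, exists_prop]
  constructor
  · rintro ⟨σ, hσ, hx⟩
    exact ⟨(List.range (maxLength F)).map x, ⟨by simp, σ, hσ,
      (isPrefix_map_range (le_maxLength hσ)).2 hx⟩, mem_Cyl.2 (by simp)⟩
  · rintro ⟨v, ⟨hv, σ, hσ, hp⟩, hx⟩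
    refine ⟨σ, hσ, (isPrefix_map_range hp.length_le).1 ?_⟩
    rwa [mem_Cyl.1 hx]

theorem listMeasure_eq_cantor (F : List (List Bool)) :
    (listMeasure F : ℝ) = cantor.real (ClopSet F) := by
  have h : cantor (ClopSet F) = (extensions F).length * 2⁻¹ ^ maxLength F := by
    rw [ClopSet_eq_biUnion_extensions, measure_biUnion_finset _ fun v _ => measurableSet_Cyl v]
    · rw [Finset.sum_congr rfl (g := fun _ => 2⁻¹ ^ maxLength F), Finset.sum_const,
        List.toFinset_card_of_nodup (nodup_extensions F), nsmul_eq_mul]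
      intro v hv
      rw [List.mem_toFinset, mem_extensions] at hv
      rw [cantor_Cyl, hv.1]
    · intro v hv w hw hne
      rw [Finset.mem_coe, List.mem_toFinset, mem_extensions] at hv hw
      refine Set.disjoint_left.2 fun x hx hx' => hne ?_
      rw [← mem_Cyl.1 hx, ← mem_Cyl.1 hx', hv.1, hw.1]
  rw [listMeasure_eq, Measure.real, h]
  simp [div_eq_mul_inv]

theorem openMeasure_eq_cantor (g : ℕ → List (List Bool)) :
    openMeasure g = cantor.real (OpenSet g) := by
  have hU : OpenSet g = ⋃ s, ClopSet ((List.range (s + 1)).flatMap g) := by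
    ext x
    simp only [OpenSet, Set.mem_iUnion, mem_ClopSet_flatMap, List.mem_range]
    exact ⟨fun ⟨s, hs⟩ => ⟨s, s, by omega, hs⟩, fun ⟨_, s, _, hs⟩ => ⟨s, hs⟩⟩
  have hm : Monotone fun s : ℕ => ClopSet ((List.range (s + 1)).flatMap g) := by
    intro s t hst x
    simp only [mem_ClopSet_flatMap, List.mem_range]
    exact fun ⟨i, hi, hx⟩ => ⟨i, by omega, hx⟩
  rw [openMeasure, hU]
  simp only [listMeasure_eq_cantor]
  have ht := (ENNReal.tendsto_toReal (measure_ne_top cantor _)).comp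
    (tendsto_measure_iUnion_atTop (μ := cantor) hm)
  exact tendsto_nhds_unique (tendsto_atTop_ciSup
    (fun s t hst => measureReal_mono (hm hst))
      ⟨1, by rintro _ ⟨s, rfl⟩; exact measureReal_le_one⟩) ht

end CantorMeasure

/-! ### From hyperimmunity to engulfing -/

section Engulfing

open MeasureTheory Nat.Partrec
open scoped ENNReal

/-- `F` if its measure is at most `2 ^ (-j)`, and the empty list otherwise. -/
noncomputable def restrictMeasure (j : ℕ) (F : List (List Bool)) : List (List Bool) :=
  if (extensions F).length * 2 ^ j ≤ 2 ^ maxLength F then F else []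

theorem le_iff_listMeasure_le {j : ℕ} {F : List (List Bool)} :
    (extensions F).length * 2 ^ j ≤ 2 ^ maxLength F ↔ listMeasure F ≤ (1 / 2) ^ j := by
  rw [listMeasure_eq, one_div, inv_pow, ← one_div, div_le_div_iff₀ (by positivity) (by positivity),
    one_mul]
  exact_mod_cast Iff.rfl

theorem listMeasure_nil : listMeasure [] = 0 := by
  rw [listMeasure_eq]
  simp [extensions]

theorem listMeasure_restrictMeasure_le (j : ℕ) (F : List (List Bool)) :
    listMeasure (restrictMeasure j F) ≤ (1 / 2) ^ j := by
  unfold restrictMeasure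
  split_ifs with h
  · exact le_iff_listMeasure_le.1 h
  · rw [listMeasure_nil]; positivity

theorem restrictMeasure_eq_self {j : ℕ} {F : List (List Bool)}
    (h : listMeasure F ≤ (1 / 2) ^ j) : restrictMeasure j F = F :=
  if_pos (le_iff_listMeasure_le.2 h)

theorem primrec_restrictMeasure : Primrec₂ restrictMeasure := by
  refine Primrec.ite (Primrec.nat_le.comp (Primrec.nat_mul.comp (Primrec.list_length.comp
    (primrec_extensions.comp Primrec.snd)) (primrec_two_pow.comp Primrec.fst))
    (primrec_two_pow.comp (primrec_maxLength.comp Primrec.snd))) Primrec.snd (Primrec.const [])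

/-- The `(2 * n + 1)`-st component of the `e`-th candidate Kurtz test, computed for `t` steps. -/
noncomputable def candidate (n t e : ℕ) : List (List Bool) :=
  restrictMeasure (2 * n + 1)
    (((Code.evaln t (Denumerable.ofNat Code e) (2 * n + 1)).bind Encodable.decode).getD [])

/-- The union of the first `n + 1` candidates. -/
noncomputable def stage (n t : ℕ) : List (List Bool) :=
  (List.range (n + 1)).flatMap (candidate n t)

theorem primrec_stage : Primrec₂ stage := by
  refine Primrec.list_flatMap (Primrec.list_range.comp (Primrec.succ.comp Primrec.fst)) ?_
  have hn : Primrec fun p : (ℕ × ℕ) × ℕ => 2 * p.1.1 + 1 :=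
    Primrec.succ.comp (Primrec.nat_mul.comp (Primrec.const 2) (Primrec.fst.comp Primrec.fst))
  refine primrec_restrictMeasure.comp hn (Primrec.option_getD.comp (Primrec.option_bind ?_
    (Primrec.decode.comp Primrec.snd)) (Primrec.const []))
  exact Code.primrec_evaln.comp (((Primrec.snd.comp Primrec.fst).pair
    ((Primrec.ofNat Code).comp Primrec.snd)).pair hn)

theorem cantor_le_of_listMeasure_le {F : List (List Bool)} {j : ℕ}
    (h : listMeasure F ≤ (1 / 2) ^ j) : cantor (ClopSet F) ≤ 2⁻¹ ^ j := by
  have h' : cantor.real (ClopSet F) ≤ (1 / 2) ^ j := by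
    rw [← listMeasure_eq_cantor]
    have := Rat.cast_le (K := ℝ) |>.2 h
    push_cast at this
    exact this
  rw [Measure.real] at h'
  rw [← ENNReal.toReal_le_toReal (measure_ne_top _ _) (by simp)]
  simpa using h'

theorem cantor_stage_le (n t : ℕ) : cantor (ClopSet (stage n t)) ≤ 2⁻¹ ^ (n + 1) := by
  have h : ClopSet (stage n t) = ⋃ e ∈ Finset.range (n + 1), ClopSet (candidate n t e) := by
    ext x
    simp [stage, mem_ClopSet_flatMap]
  calc cantor (ClopSet (stage n t))
      ≤ ∑ e ∈ Finset.range (n + 1), cantor (ClopSet (candidate n t e)) :=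
        h ▸ measure_biUnion_finset_le _ _
    _ ≤ ∑ e ∈ Finset.range (n + 1), 2⁻¹ ^ (2 * n + 1) := Finset.sum_le_sum fun e _ =>
        cantor_le_of_listMeasure_le (listMeasure_restrictMeasure_le _ _)
    _ = ((n + 1 : ℕ) : ℝ≥0∞) * (2⁻¹ ^ n * 2⁻¹ ^ (n + 1)) := by
        rw [Finset.sum_const, Finset.card_range, nsmul_eq_mul, ← pow_add]
        congr 2; omega
    _ ≤ (2 ^ n : ℕ) * (2⁻¹ ^ n * 2⁻¹ ^ (n + 1)) := by
        gcongr
        exact Nat.lt_two_pow_self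
    _ = 2⁻¹ ^ (n + 1) := by
        rw [← mul_assoc]
        push_cast
        rw [← mul_pow, ENNReal.mul_inv_cancel two_ne_zero ENNReal.ofNat_ne_top, one_pow, one_mul]

theorem cantor_iUnion_stage_le (f : ℕ → ℕ) (m : ℕ) :
    cantor (⋃ s, ClopSet (stage (m + s) (f (m + s)))) ≤ 2⁻¹ ^ m := by
  calc cantor (⋃ s, ClopSet (stage (m + s) (f (m + s))))
      ≤ ∑' s, cantor (ClopSet (stage (m + s) (f (m + s)))) := measure_iUnion_le _
    _ ≤ ∑' s, 2⁻¹ ^ m * 2⁻¹ ^ (s + 1) := ENNReal.tsum_le_tsum fun s => by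
        rw [← pow_add]; exact cantor_stage_le _ _
    _ = 2⁻¹ ^ m := by
        rw [ENNReal.tsum_mul_left, ENNReal.tsum_geometric_add_one]
        simp [ENNReal.inv_mul_cancel]

theorem ClopSet_subset_stage {L : ℕ → List (List Bool)} (hL : KurtzTest L) :
    ∃ (t : ℕ → ℕ) (e : ℕ), Computable t ∧ ∀ n s, e ≤ n → t n ≤ s →
      ClopSet (L (2 * n + 1)) ⊆ ClopSet (stage n s) := by
  obtain ⟨c, hc⟩ := Code.exists_code.1 hL.1
  have hev (k : ℕ) : Encodable.encode (L k) ∈ c.eval k := by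
    rw [hc]; simp
  have hex (n : ℕ) : ∃ s, (Code.evaln s c (2 * n + 1)).isSome := by
    obtain ⟨s, hs⟩ := Code.evaln_complete.1 (hev (2 * n + 1))
    exact ⟨s, Option.isSome_iff_exists.2 ⟨_, hs⟩⟩
  refine ⟨fun n => Nat.find (hex n), Encodable.encode c, ?_, fun n s hn hs x hx => ?_⟩
  · refine computable_search (p := fun n s => (Code.evaln s c (2 * n + 1)).isSome)
      ⟨fun q => (Code.evaln q.2 c (2 * q.1 + 1)).isSome, ?_, by simp⟩
      (fun n => Nat.find_spec (hex n))
      (fun n m hm => Nat.find_min (hex n) hm)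
    refine (Primrec.option_isSome.comp (Code.primrec_evaln.comp ((Primrec.snd.pair
      (Primrec.const c)).pair (Primrec.succ.comp (Primrec.nat_mul.comp (Primrec.const 2)
      Primrec.fst))))).to_comp
  · have hsome : Code.evaln s c (2 * n + 1) = some (Encodable.encode (L (2 * n + 1))) := by
      obtain ⟨v, hv⟩ := Option.isSome_iff_exists.1 (Nat.find_spec (hex n))
      have hv' := Code.evaln_mono hs hv
      rwa [← Part.mem_unique (Code.evaln_sound hv') (hev _)]
    refine mem_ClopSet_flatMap.2 ⟨Encodable.encode c, List.mem_range.2 (by omega), ?_⟩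
    rw [candidate, Denumerable.ofNat_encode, hsome, Option.bind_some, Encodable.encodek,
      Option.getD_some, restrictMeasure_eq_self (hL.2 _)]
    exact hx

theorem mem_ClopSet_flatten_drop {x : ℕ → Bool} {C : ℕ → List (List Bool)} {m k : ℕ} :
    x ∈ ClopSet (((List.range (m + k)).map C).drop m).flatten ↔
      ∃ s < k, x ∈ ClopSet (C (m + s)) := by
  rw [← List.map_drop, ← List.flatMap_def, mem_ClopSet_flatMap]
  simp only [List.range_eq_range', List.drop_range', List.mem_range'_1]
  constructor
  · rintro ⟨i, hi, hx⟩
    exact ⟨i - m, by omega, by rwa [Nat.add_sub_cancel' (by omega)]⟩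
  · rintro ⟨s, hs, hx⟩
    exact ⟨m + s, by omega, hx⟩

theorem computableIn_listMeasure_flatten_drop {A : Set ℕ} {C : ℕ → List (List Bool)}
    (hC : ComputableIn A C) : ComputableIn A fun p : ℕ × ℕ =>
      listMeasure (((List.range (p.1 + p.2)).map C).drop p.1).flatten := by
  have h₁ : Computable fun q : ℕ × List (List (List Bool)) =>
      listMeasure (q.2.drop q.1).flatten :=
    computable_listMeasure.comp (Primrec.list_flatten.comp Primrec.list_drop).to_comp
  have h₂ : ComputableIn A fun p : ℕ × ℕ => (p.1, (List.range (p.1 + p.2)).map C) :=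
    (ComputableIn.of_computable Computable.fst).pair
      (hC.map_range.comp (ComputableIn.of_computable Primrec.nat_add.to_comp))
  have h₃ := (ComputableIn.of_computable (A := A) h₁).comp h₂
  exact h₃

theorem exists_schnorrNullIn_of_hyperimmuneDegree {A : Set ℕ} (hA : HyperimmuneDegree A) :
    ∃ N, SchnorrNullIn A N ∧ ∀ L, KurtzTest L → (⋂ m, ClopSet (L m)) ⊆ N := by
  obtain ⟨f, hf, hdom⟩ := hA
  have hs : ComputableIn A fun p : ℕ × ℕ => stage p.1 p.2 :=
    ComputableIn.of_computable primrec_stage.to_comp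
  have hC := hs.comp ((ComputableIn.of_computable Computable.id).pair hf)
  set C : ℕ → List (List Bool) := fun n => stage n (f n) with hCdef
  change ComputableIn A C at hC
  refine ⟨⋂ m, OpenSet fun s => C (m + s), ⟨fun m s => C (m + s), ⟨?_, fun m => ?_,
    fun p => listMeasure (((List.range (p.1 + p.2)).map C).drop p.1).flatten, ?_, fun m k => ?_⟩,
    subset_rfl⟩, fun L hL x hx => ?_⟩
  · have h := hC.comp (ComputableIn.of_computable Primrec.nat_add.to_comp)
    exact h
  · rw [openMeasure_eq_cantor, Measure.real]
    have := ENNReal.toReal_mono (by simp) (cantor_iUnion_stage_le f m)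
    refine le_trans this ?_
    simp
  · exact computableIn_listMeasure_flatten_drop hC
  · have hsub : ClopSet (((List.range (m + k)).map C).drop m).flatten ⊆
        OpenSet fun s => C (m + s) := fun x hx => by
      obtain ⟨s, _, hs⟩ := mem_ClopSet_flatten_drop.1 hx
      exact Set.mem_iUnion.2 ⟨s, hs⟩
    have hsub' : (OpenSet fun s => C (m + s)) ⊆
        ClopSet (((List.range (m + k)).map C).drop m).flatten ∪
          ⋃ s, ClopSet (stage (m + k + s) (f (m + k + s))) := fun x hx => by
      obtain ⟨s, hs⟩ := Set.mem_iUnion.1 hx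
      rcases lt_or_ge s k with h | h
      · exact Or.inl (mem_ClopSet_flatten_drop.2 ⟨s, h, hs⟩)
      · refine Or.inr (Set.mem_iUnion.2 ⟨s - k, ?_⟩)
        rwa [show m + k + (s - k) = m + s by omega]
    rw [openMeasure_eq_cantor, listMeasure_eq_cantor, abs_of_nonneg
      (sub_nonneg.2 (measureReal_mono hsub)), sub_le_iff_le_add']
    refine ((measureReal_mono hsub').trans (measureReal_union_le _ _)).trans ?_
    gcongr
    have := ENNReal.toReal_mono (by simp) (cantor_iUnion_stage_le f (m + k))
    refine (le_trans this ?_)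
    rw [ENNReal.toReal_pow, ENNReal.toReal_inv, ENNReal.toReal_ofNat, one_div]
    exact pow_le_pow_of_le_one (by norm_num) (by norm_num) (by omega)
  · obtain ⟨t, e, ht, hte⟩ := ClopSet_subset_stage hL
    refine Set.mem_iInter.2 fun m => ?_
    obtain ⟨n, hn, hlt⟩ := frequently_atTop.1 (hdom t ht) (max m e)
    refine Set.mem_iUnion.2 ⟨n - m, ?_⟩
    dsimp only
    rw [Nat.add_sub_cancel' (le_of_max_le_left hn)]
    exact hte n (f n) (le_of_max_le_right hn) hlt.le (Set.mem_iInter.1 hx _)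

end Engulfing

/-! ### From engulfing to hyperimmunity -/

section Hyperimmune

open MeasureTheory
open scoped ENNReal

theorem exists_strictMono_bound {d g : ℕ → ℕ} (hg : Computable g) (h : ∀ᶠ n in atTop, d n ≤ g n) :
    ∃ b : ℕ → ℕ, Computable b ∧ StrictMono b ∧ ∀ n, d n ≤ b n := by
  obtain ⟨N, hN⟩ := eventually_atTop.1 h
  set B := ∑ i ∈ Finset.range N, d i with hB
  have hle (n : ℕ) : d n ≤ g n + B := by
    rcases lt_or_ge n N with hn | hn
    · exact (Finset.single_le_sum (fun i _ => Nat.zero_le (d i)) (Finset.mem_range.2 hn)).trans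
        (Nat.le_add_left _ _)
    · exact (hN n hn).trans (Nat.le_add_right _ _)
  refine ⟨fun n => Nat.rec (g 0 + B) (fun n b => b + (g (n + 1) + B) + 1) n, ?_,
    strictMono_nat_of_lt_succ fun n => ?_, fun n => ?_⟩
  · refine Computable.nat_rec (f := fun n : ℕ => n) (g := fun _ => g 0 + B)
      (h := fun _ p => p.2 + (g (p.1 + 1) + B) + 1) Computable.id (Computable.const _) ?_
    have h₁ : Computable fun q : ℕ × ℕ × ℕ => g (q.2.1 + 1) :=
      hg.comp (Computable.succ.comp (Computable.fst.comp Computable.snd))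
    have h₂ : Computable fun q : ℕ × ℕ × ℕ => g (q.2.1 + 1) + B :=
      Primrec.nat_add.to_comp.comp h₁ (Computable.const B)
    exact Computable.succ.comp (Primrec.nat_add.to_comp.comp
      (Computable.snd.comp Computable.snd) h₂)
  · dsimp only; omega
  · cases n with
    | zero => exact hle 0
    | succ n => exact (hle (n + 1)).trans (by dsimp only; omega)

theorem computable_map_range {h : ℕ → ℕ} (hh : Computable h) :
    Computable fun n => (List.range n).map h := by
  have hrec : Computable fun n : ℕ => (Nat.rec [] (fun y l => l ++ [h y]) n : List ℕ) := by
    refine Computable.nat_rec (f := fun n : ℕ => n) (g := fun _ => ([] : List ℕ))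
      (h := fun _ p => p.2 ++ [h p.1]) Computable.id (Computable.const _) ?_
    exact Primrec.list_concat.to_comp.comp (Computable.snd.comp Computable.snd)
      (hh.comp (Computable.fst.comp Computable.snd))
  refine hrec.of_eq fun n => ?_
  induction n with
  | zero => rfl
  | succ n ih => rw [List.range_succ, List.map_append, ← ih]; rfl

/-- The strings of length `h m` that vanish at the positions `h 0, …, h (m - 1)`. -/
def vanishingStrings (h : ℕ → ℕ) (m : ℕ) : List (List Bool) :=
  (allStrings (h m)).filter fun v => ∀ i ∈ (List.range m).map h, v.getD i false = false

theorem computable_vanishingStrings {h : ℕ → ℕ} (hh : Computable h) :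
    Computable (vanishingStrings h) := by
  have hR : PrimrecRel fun (i : ℕ) (v : List Bool) => v.getD i false = false :=
    Primrec.eq.comp ((Primrec.list_getD false).comp Primrec.snd Primrec.fst) (Primrec.const false)
  have hR' : PrimrecRel fun (v : List Bool) (l : List ℕ) => ∀ i ∈ l, v.getD i false = false :=
    (PrimrecRel.forall_mem_list hR).comp Primrec.snd Primrec.fst
  exact (PrimrecRel.listFilter hR').to_comp.comp (primrec_allStrings.to_comp.comp hh)
    (computable_map_range hh)

theorem ClopSet_vanishingStrings {h : ℕ → ℕ} (hh : StrictMono h) (m : ℕ) :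
    ClopSet (vanishingStrings h m) =
      {x | ∀ i ∈ (Finset.range m).image h, x i = (fun _ => false : ℕ → Bool) i} := by
  ext x
  have hget (i : ℕ) (hi : i < m) : ((List.range (h m)).map x).getD (h i) false = x (h i) := by
    simp [List.getD_eq_getElem?_getD, hh hi]
  simp only [mem_ClopSet, vanishingStrings, List.mem_filter, mem_allStrings, decide_eq_true_eq,
    List.forall_mem_map, List.mem_range, Finset.forall_mem_image, Finset.mem_range,
    Set.mem_ofPred_eq, mem_Cyl]
  constructor
  · rintro ⟨v, ⟨hv, H⟩, hx⟩ i hi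
    rw [hv] at hx
    rw [← hget i hi, hx]
    exact H i hi
  · intro H
    exact ⟨(List.range (h m)).map x, ⟨by simp, fun i hi => (hget i hi).trans (H hi)⟩, by simp⟩

theorem kurtzTest_vanishingStrings {h : ℕ → ℕ} (hc : Computable h) (hh : StrictMono h) :
    KurtzTest (vanishingStrings h) := by
  refine ⟨computable_vanishingStrings hc, fun m => le_of_eq ?_⟩
  have : (listMeasure (vanishingStrings h m) : ℝ) = (((1 / 2) ^ m : ℚ) : ℝ) := by
    rw [listMeasure_eq_cantor, ClopSet_vanishingStrings hh, Measure.real, cantor_pi,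
      Finset.card_image_of_injective _ hh.injective, Finset.card_range]
    simp
  exact_mod_cast this

theorem measurable_update_false (j : ℕ) :
    Measurable fun x : ℕ → Bool => Function.update x j false :=
  measurable_pi_iff.2 fun i => by
    by_cases hi : i = j
    · subst hi; simp
    · simpa [hi] using measurable_pi_apply i

theorem cantor_preimage_update_le (j : ℕ) {D : Set (ℕ → Bool)} (hD : MeasurableSet D) :
    cantor ((fun x => Function.update x j false) ⁻¹' D) ≤ 2 * cantor D := by
  let φ : ℕ → Bool → Bool := fun i => if i = j then not else id
  have hφ : Measurable fun (x : ℕ → Bool) i => φ i (x i) :=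
    measurable_pi_iff.2 fun i => (measurable_of_finite (φ i)).comp (measurable_pi_apply i)
  have hmap : cantor.map (fun x i => φ i (x i)) = cantor := by
    rw [cantor, Measure.infinitePi_map_pi _ fun i => measurable_of_finite (φ i)]
    congr 1
    funext i
    by_cases hi : i = j
    · simp only [φ, if_pos hi, coin_map_not]
    · simp only [φ, if_neg hi, Measure.map_id]
  have hsub : (fun x => Function.update x j false) ⁻¹' D ⊆
      D ∪ (fun (x : ℕ → Bool) i => φ i (x i)) ⁻¹' D := by
    intro x hx
    cases hxj : x j with
    | false =>
      left
      have : Function.update x j false = x := by rw [← hxj, Function.update_eq_self]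
      rwa [Set.mem_preimage, this] at hx
    | true =>
      right
      have : Function.update x j false = fun i => φ i (x i) := by
        funext i
        by_cases hi : i = j
        · subst hi; simp [φ, hxj]
        · simp [φ, hi]
      rwa [Set.mem_preimage, this] at hx
  calc _ ≤ cantor D + cantor ((fun (x : ℕ → Bool) i => φ i (x i)) ⁻¹' D) :=
        (measure_mono hsub).trans (measure_union_le _ _)
    _ = 2 * cantor D := by rw [← Measure.map_apply hφ hD, hmap, two_mul]

/-- Replace the bits of `x` at the positions `h 0, …, h (k - 1)` by zeros. -/
def vanish (h : ℕ → ℕ) (x : ℕ → Bool) (k : ℕ) : ℕ → Bool :=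
  Nat.rec x (fun j y => Function.update y (h j) false) k

theorem vanish_succ (h : ℕ → ℕ) (x : ℕ → Bool) (k : ℕ) :
    vanish h x (k + 1) = Function.update (vanish h x k) (h k) false := rfl

theorem cantor_preimage_vanish_le (h : ℕ → ℕ) (k : ℕ) {D : Set (ℕ → Bool)}
    (hD : MeasurableSet D) : cantor ((fun x => vanish h x k) ⁻¹' D) ≤ 2 ^ k * cantor D := by
  induction k generalizing D with
  | zero => simp [vanish]
  | succ k ih =>
    calc cantor ((fun x => vanish h x (k + 1)) ⁻¹' D)
        ≤ 2 ^ k * cantor ((fun x => Function.update x (h k) false) ⁻¹' D) :=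
          ih (measurable_update_false (h k) hD)
      _ ≤ 2 ^ k * (2 * cantor D) := by gcongr; exact cantor_preimage_update_le _ hD
      _ = 2 ^ (k + 1) * cantor D := by rw [pow_succ, mul_assoc]

open scoped Classical in
theorem vanish_apply (h : ℕ → ℕ) (x : ℕ → Bool) (k i : ℕ) :
    vanish h x k i = if ∃ j < k, h j = i then false else x i := by
  induction k with
  | zero => simp [vanish]
  | succ k ih =>
    rw [vanish_succ, Function.update_apply, ih]
    simp only [Nat.lt_succ_iff_lt_or_eq, or_and_right, exists_or, exists_eq_left, eq_comm (a := i)]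
    by_cases h₁ : h k = i <;> by_cases h₂ : ∃ j < k, h j = i <;> simp [h₁, h₂]

/-- If the set `D k` is determined by the bits below `h k` and has measure at most
`2 ^ (-2 * k - 2)`, for all `k`, then some sequence vanishing on the range of `h` is in no `D k`. -/
theorem exists_vanishing_notMem {h : ℕ → ℕ} (hh : StrictMono h) {D : ℕ → Set (ℕ → Bool)}
    (hD : ∀ k, MeasurableSet (D k))
    (hbits : ∀ k x y, (∀ i < h k, x i = y i) → x ∈ D k → y ∈ D k)
    (hle : ∀ k, cantor (D k) ≤ 2⁻¹ ^ (2 * k + 2)) :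
    ∃ x : ℕ → Bool, (∀ k, x (h k) = false) ∧ ∀ k, x ∉ D k := by
  classical
  let Z : (ℕ → Bool) → ℕ → Bool := fun x i => if ∃ j, h j = i then false else x i
  have hZ (x : ℕ → Bool) (k i : ℕ) (hi : i < h k) : Z x i = vanish h x k i := by
    rw [vanish_apply]
    have : (∃ j, h j = i) ↔ ∃ j < k, h j = i :=
      ⟨fun ⟨j, hj⟩ => ⟨j, hh.lt_iff_lt.1 (hj ▸ hi), hj⟩, fun ⟨j, _, hj⟩ => ⟨j, hj⟩⟩
    simp only [Z, this]
  have hlt : cantor (⋃ k, (fun x => vanish h x k) ⁻¹' D k) < 1 := by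
    calc cantor (⋃ k, (fun x => vanish h x k) ⁻¹' D k)
        ≤ ∑' k, cantor ((fun x => vanish h x k) ⁻¹' D k) := measure_iUnion_le _
      _ ≤ ∑' k, 2⁻¹ * 2⁻¹ ^ (k + 1) := ENNReal.tsum_le_tsum fun k => by
          refine (cantor_preimage_vanish_le h k (hD k)).trans ?_
          calc 2 ^ k * cantor (D k) ≤ 2 ^ k * 2⁻¹ ^ (2 * k + 2) := by gcongr; exact hle k
            _ = (2 ^ k * 2⁻¹ ^ k) * (2⁻¹ * 2⁻¹ ^ (k + 1)) := by ring
            _ = 2⁻¹ * 2⁻¹ ^ (k + 1) := by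
              rw [← mul_pow, ENNReal.mul_inv_cancel two_ne_zero ENNReal.ofNat_ne_top, one_pow,
                one_mul]
      _ = 2⁻¹ := by
          rw [ENNReal.tsum_mul_left, ENNReal.tsum_geometric_add_one]
          simp [ENNReal.inv_mul_cancel]
      _ < 1 := ENNReal.inv_lt_one.2 (by norm_num)
  obtain ⟨x, hx⟩ : ∃ x, x ∉ ⋃ k, (fun x => vanish h x k) ⁻¹' D k := by
    by_contra! H
    rw [Set.eq_univ_of_forall H, measure_univ] at hlt
    exact lt_irrefl _ hlt
  refine ⟨Z x, fun k => if_pos ⟨k, rfl⟩, fun k hk => hx (Set.mem_iUnion.2 ⟨k, ?_⟩)⟩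
  exact hbits k _ _ (hZ x k) hk

end Hyperimmune

/-! ### From Schnorr null sets to vanishing strings -/

section Converse

open MeasureTheory

/-- A decidable form of the inequality `r < listMeasure F + 2 * 2 ^ (-i)`. -/
def IsClose (i : ℕ) (r : ℚ) (F : List (List Bool)) : Prop :=
  r.num.toNat * (2 ^ i * 2 ^ maxLength F) <
    ((extensions F).length * 2 ^ i + 2 * 2 ^ maxLength F) * r.den

noncomputable instance (i : ℕ) (r : ℚ) (F : List (List Bool)) : Decidable (IsClose i r F) :=
  inferInstanceAs (Decidable (_ < _))

theorem isClose_iff {i : ℕ} {r : ℚ} {F : List (List Bool)} :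
    IsClose i r F ↔ r < listMeasure F + 2 * (1 / 2) ^ i := by
  have hd : (0 : ℚ) < r.den := by exact_mod_cast r.pos
  have hrhs : listMeasure F + 2 * (1 / 2) ^ i =
      ((extensions F).length * 2 ^ i + 2 * 2 ^ maxLength F) / (2 ^ i * 2 ^ maxLength F) := by
    rw [listMeasure_eq, one_div, inv_pow]
    field_simp
  rcases le_or_gt 0 r.num with hr | hr
  · have hrd : r = (r.num.toNat : ℚ) / r.den := by
      rw [← Int.cast_natCast r.num.toNat, Int.toNat_of_nonneg hr, Rat.num_div_den]
    rw [hrhs]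
    conv_rhs => rw [hrd]
    rw [div_lt_div_iff₀ hd (by positivity), IsClose]
    exact_mod_cast Iff.rfl
  · refine iff_of_true ?_ ?_
    · rw [IsClose, Int.toNat_of_nonpos hr.le, Nat.zero_mul]
      exact Nat.mul_pos (by positivity) r.pos
    · rw [hrhs]
      exact (Rat.num_neg.1 hr).trans_le (by positivity)

theorem computable_isClose :
    Computable fun p : ℕ × ℚ × List (List Bool) => decide (IsClose p.1 p.2.1 p.2.2) := by
  have h : Primrec fun t : ℕ × (ℕ × ℕ) × List (List Bool) =>
      decide (t.2.1.1 * (2 ^ t.1 * 2 ^ maxLength t.2.2) <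
        ((extensions t.2.2).length * 2 ^ t.1 + 2 * 2 ^ maxLength t.2.2) * t.2.1.2) := by
    have hF : Primrec fun t : ℕ × (ℕ × ℕ) × List (List Bool) => t.2.2 :=
      Primrec.snd.comp Primrec.snd
    have hn : Primrec fun t : ℕ × (ℕ × ℕ) × List (List Bool) => t.2.1 :=
      Primrec.fst.comp Primrec.snd
    have hi : Primrec fun t : ℕ × (ℕ × ℕ) × List (List Bool) => 2 ^ t.1 :=
      primrec_two_pow.comp Primrec.fst
    have hM := primrec_two_pow.comp (primrec_maxLength.comp hF)
    have hN := Primrec.list_length.comp (primrec_extensions.comp hF)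
    exact (Primrec.nat_lt.comp
      (Primrec.nat_mul.comp (Primrec.fst.comp hn) (Primrec.nat_mul.comp hi hM))
      (Primrec.nat_mul.comp (Primrec.nat_add.comp (Primrec.nat_mul.comp hN hi)
        (Primrec.nat_mul.comp (Primrec.const 2) hM)) (Primrec.snd.comp hn))).decide
  have hr : Computable fun p : ℕ × ℚ × List (List Bool) => p.2.1 :=
    Computable.fst.comp Computable.snd
  have hc : Computable fun p : ℕ × ℚ × List (List Bool) =>
      (p.1, (p.2.1.num.toNat, p.2.1.den), p.2.2) :=
    Computable.fst.pair (((computable_rat_num_toNat.comp hr).pair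
      (computable_rat_den.comp hr)).pair (Computable.snd.comp Computable.snd))
  have h' := h.to_comp.comp hc
  exact h'

theorem mem_ClopSet_flatten_map_range {x : ℕ → Bool} {G : ℕ → List (List Bool)} {k : ℕ} :
    x ∈ ClopSet ((List.range k).map G).flatten ↔ ∃ s < k, x ∈ ClopSet (G s) := by
  simp only [← List.flatMap_def, mem_ClopSet_flatMap, List.mem_range]

/-- An open set with computable measure is approximated from inside by an `A`-computable
sequence of clopen sets. -/
theorem exists_clopen_approx {A : Set ℕ} {G : ℕ → List (List Bool)} (hG : ComputableIn A G)
    {r : ℕ → ℚ} (hr : ComputableIn A r)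
    (happ : ∀ k, |openMeasure G - (r k : ℝ)| ≤ (1 / 2) ^ k) :
    ∃ F : ℕ → List (List Bool), ComputableIn A F ∧ (∀ k, ClopSet (F k) ⊆ OpenSet G) ∧
      OpenSet G ⊆ ⋃ k, ClopSet (F k) ∧
      ∀ k, cantor.real (OpenSet G \ ClopSet (F k)) ≤ (1 / 2) ^ (2 * k + 4) := by
  have hlist : ComputableIn A fun p : ℕ × ℕ => ((List.range (p.1 + p.2)).map G).flatten := by
    have h₁ := hG.map_range.comp (ComputableIn.of_computable Primrec.nat_add.to_comp)
    have h₂ := (ComputableIn.of_computable (A := A)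
      (Primrec.list_flatten (α := List Bool)).to_comp).comp h₁
    exact h₂
  have hidx : Computable fun k : ℕ => 2 * k + 6 :=
    (Primrec.nat_add.comp (Primrec.nat_mul.comp (Primrec.const 2) Primrec.id)
      (Primrec.const 6)).to_comp
  have hi : ComputableIn A fun p : ℕ × ℕ => 2 * p.1 + 6 :=
    .of_computable (hidx.comp Computable.fst)
  have hri := hr.comp hi
  have htest : ComputableIn A fun p : ℕ × ℕ => decide (IsClose (2 * p.1 + 6) (r (2 * p.1 + 6))
      ((List.range (p.1 + p.2)).map G).flatten) := by
    have h₁ := hi.pair (hri.pair hlist)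
    have h₂ := (ComputableIn.of_computable (A := A) computable_isClose).comp h₁
    exact h₂
  have hsub (k : ℕ) : ClopSet ((List.range k).map G).flatten ⊆ OpenSet G := fun x hx => by
    obtain ⟨s, _, hs⟩ := mem_ClopSet_flatten_map_range.1 hx
    exact Set.mem_iUnion.2 ⟨s, hs⟩
  obtain ⟨s, hs, hclose⟩ := htest.exists_search fun k => by
    have hpos : (0 : ℝ) < (1 / 2) ^ (2 * k + 6) := by positivity
    obtain ⟨s, hs⟩ := exists_lt_of_lt_ciSup
      (show openMeasure G - (1 / 2) ^ (2 * k + 6) < openMeasure G by linarith)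
    refine ⟨s + 1, decide_eq_true (isClose_iff.2 ?_)⟩
    have hmono : (listMeasure ((List.range (s + 1)).flatMap G) : ℝ) ≤
        listMeasure ((List.range (k + (s + 1))).map G).flatten := by
      rw [listMeasure_eq_cantor, listMeasure_eq_cantor]
      refine measureReal_mono fun x hx => ?_
      rw [List.flatMap_def] at hx
      obtain ⟨t, ht, hx⟩ := mem_ClopSet_flatten_map_range.1 hx
      exact mem_ClopSet_flatten_map_range.2 ⟨t, by omega, hx⟩
    have := (abs_le.1 (happ (2 * k + 6))).1
    dsimp only
    rw [← Rat.cast_lt (K := ℝ)]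
    push_cast
    linarith
  refine ⟨fun k => ((List.range (k + s k)).map G).flatten, ?_, fun k => hsub _, fun x hx => ?_,
    fun k => ?_⟩
  · have h₁ := hlist.comp ((ComputableIn.of_computable Computable.id).pair hs)
    exact h₁
  · obtain ⟨t, ht⟩ := Set.mem_iUnion.1 hx
    exact Set.mem_iUnion.2 ⟨t + 1, mem_ClopSet_flatten_map_range.2 ⟨t, by omega, ht⟩⟩
  · have h₁ := isClose_iff.1 (of_decide_eq_true (hclose k))
    rw [← Rat.cast_lt (K := ℝ)] at h₁
    push_cast at h₁
    have h₂ := (abs_le.1 (happ (2 * k + 6))).2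
    rw [measureReal_sdiff (hsub _) (measurableSet_ClopSet _), ← openMeasure_eq_cantor,
      ← listMeasure_eq_cantor]
    have h₃ : (1 / 2 : ℝ) ^ (2 * k + 4) = 4 * (1 / 2) ^ (2 * k + 6) := by ring
    have h₄ : (0 : ℝ) < (1 / 2) ^ (2 * k + 6) := by positivity
    linarith

theorem cantor_le_of_real_le {S : Set (ℕ → Bool)} {j : ℕ} (h : cantor.real S ≤ (1 / 2) ^ j) :
    cantor S ≤ 2⁻¹ ^ j := by
  rw [← ofReal_measureReal]
  refine (ENNReal.ofReal_le_ofReal h).trans_eq ?_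
  rw [ENNReal.ofReal_pow (by norm_num), one_div, ENNReal.ofReal_inv_of_pos two_pos,
    ENNReal.ofReal_ofNat]

theorem hyperimmuneDegree_of_schnorrNullIn {A : Set ℕ} {N : Set (ℕ → Bool)}
    (hN : SchnorrNullIn A N) (hL : ∀ L, KurtzTest L → (⋂ m, ClopSet (L m)) ⊆ N) :
    HyperimmuneDegree A := by
  obtain ⟨g, ⟨hg, hmeas, q, hq, hqa⟩, hsub⟩ := hN
  by_contra hA
  simp only [HyperimmuneDegree, not_exists, not_and, not_forall, not_frequently, not_lt] at hA
  have htwo : ComputableIn A fun s : ℕ => (2, s) :=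
    .of_computable ((Computable.const 2).pair Computable.id)
  have hG : ComputableIn A (g 2) := hg.comp htwo
  have hr : ComputableIn A fun k => q (2, k) := by
    have h := hq.comp htwo
    exact h
  obtain ⟨F, hF, hFsub, hcover, happ⟩ := exists_clopen_approx hG hr (hqa 2)
  have hd := (ComputableIn.of_computable (A := A) primrec_maxLength.to_comp).comp hF
  obtain ⟨b, hb, hdb⟩ := hA _ hd
  obtain ⟨h, hc, hmono, hle⟩ := exists_strictMono_bound hb hdb
  have hcongr {j k : ℕ} (hjk : j ≤ k) {x y : ℕ → Bool} (hxy : ∀ i < h k, x i = y i) :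
      x ∈ ClopSet (F j) ↔ y ∈ ClopSet (F j) :=
    mem_ClopSet_congr fun i hi => hxy i (hi.trans_le ((hle j).trans (hmono.monotone hjk)))
  let D : ℕ → Set (ℕ → Bool) := fun k =>
    Nat.casesOn k (ClopSet (F 0)) fun k => ClopSet (F (k + 1)) \ ClopSet (F k)
  obtain ⟨x, hx₀, hxD⟩ := exists_vanishing_notMem hmono (D := D)
    (fun k => by
      cases k with
      | zero => exact measurableSet_ClopSet _
      | succ k => exact (measurableSet_ClopSet _).diff (measurableSet_ClopSet _))
    (fun k x y hxy hx => by
      cases k with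
      | zero => exact (hcongr le_rfl hxy).1 hx
      | succ k => exact ⟨(hcongr le_rfl hxy).1 hx.1, mt (hcongr k.le_succ hxy).2 hx.2⟩)
    (fun k => cantor_le_of_real_le (by
      cases k with
      | zero =>
        refine (measureReal_mono (hFsub 0)).trans ?_
        rw [← openMeasure_eq_cantor]
        exact hmeas 2
      | succ k => exact (measureReal_mono (Set.sdiff_subset_sdiff_left (hFsub _))).trans (happ k)))
  have hxF (k : ℕ) : x ∉ ClopSet (F k) := by
    induction k with
    | zero => exact hxD 0
    | succ k ih => exact fun hx => hxD (k + 1) ⟨hx, ih⟩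
  have hxN : x ∈ N := hL _ (kurtzTest_vanishingStrings hc hmono) (Set.mem_iInter.2 fun m => by
    rw [ClopSet_vanishingStrings hmono]
    simp [hx₀])
  obtain ⟨k, hk⟩ := Set.mem_iUnion.1 (hcover (Set.mem_iInter.1 (hsub hxN) 2))
  exact hxF k hk

end Converse

/-- `A` is of hyperimmune degree iff `A` is Schnorr-Kurtz engulfing,
i.e., some set Schnorr null relative to `A` contains every Kurtz null set. -/
theorem stmt5 (A : Set ℕ) :
    HyperimmuneDegree A ↔
      ∃ N, SchnorrNullIn A N ∧
        ∀ L, KurtzTest L → (⋂ m, ClopSet (L m)) ⊆ N := by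
  exact ⟨exists_schnorrNullIn_of_hyperimmuneDegree, fun ⟨_, hN, hL⟩ =>
    hyperimmuneDegree_of_schnorrNullIn hN hL⟩

end CichonAnalog
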